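/- For all integers h ≥ 1 and d ≥ 0 there exist a constant α > 0 and an integer ℓ₀ ≥ 1 such that every ℓ₀-coloured α-clean graph contains an (α, h, d)-junior caterpillar. -/

import Mathlib

open Finset

def Anti {V : Type} (G : SimpleGraph V) (A B : Finset V) : Prop :=
  ∀ a ∈ A, ∀ b ∈ B, ¬ G.Adj a b

def FullAdj {V : Type} (G : SimpleGraph V) (A B : Finset V) : Prop :=
  ∀ a ∈ A, ∀ b ∈ B, G.Adj a b

def ConnOn {V : Type} (G : SimpleGraph V) (A : Finset V) : Prop :=
  (G.induce (A : Set V)).Connected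

def Nbr {V : Type} [Fintype V] [DecidableEq V] (G : SimpleGraph V) [DecidableRel G.Adj]
    (A : Finset V) : Finset V :=
  Finset.univ.filter (fun v => ∃ a ∈ A, G.Adj v a)

def IsIndPath {V : Type} (G : SimpleGraph V) {h : ℕ} (f : Fin h → V) : Prop :=
  Function.Injective f ∧
    ∀ i j : Fin h, G.Adj (f i) (f j) ↔ (i.val + 1 = j.val ∨ j.val + 1 = i.val)

def colClass {V : Type} [Fintype V] [DecidableEq V] {ℓ : ℕ} (col : V → Fin ℓ) (i : Fin ℓ) :
    Finset V :=
  Finset.univ.filter (fun v => col v = i)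

def IsBud {V : Type} [Fintype V] [DecidableEq V] (G : SimpleGraph V) [DecidableRel G.Adj]
    {ℓ : ℕ} (col : V → Fin ℓ) (α : ℝ) (B : Finset V) : Prop :=
  ConnOn G B ∧ ∃ j : Fin ℓ,
    α * ((colClass col j).card : ℝ) ≤ (((Nbr G B) ∩ colClass col j).card : ℝ)

/-- A rooted tree on node type `ι`, given by its root and parent function. -/
structure RootedTreeOn (ι : Type) where
  root : ι
  parent : ι → ι
  parent_root : parent root = root
  reach : ∀ v : ι, ∃ k : ℕ, parent^[k] v = root

/-- The children of a node. -/
def RootedTreeOn.children {ι : Type} [Fintype ι] [DecidableEq ι] (T : RootedTreeOn ι)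
    (t : ι) : Finset ι :=
  Finset.univ.filter (fun c => c ≠ T.root ∧ T.parent c = t)

/-- The depth of a node: its distance to the root. -/
def RootedTreeOn.depth {ι : Type} [DecidableEq ι] (T : RootedTreeOn ι) (v : ι) : ℕ :=
  Nat.find (T.reach v)

/-- The height of a rooted tree: the maximum depth of a node. -/
def RootedTreeOn.height {ι : Type} [Fintype ι] [DecidableEq ι] (T : RootedTreeOn ι) : ℕ :=
  Finset.univ.sup (fun v => T.depth v)

/-- An `(α, d')`-fern in the `ℓ`-coloured graph `G`: a rooted tree `T` in which every
internal node has exactly `d'` children, together with a colour-compatible family `B` of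
`α`-buds, one per node, pairwise anti-adjacent except that every vertex of a parent bud
has a neighbour in each child bud. -/
def IsFern {V ι : Type} [Fintype V] [DecidableEq V] [Fintype ι] [DecidableEq ι]
    (G : SimpleGraph V) [DecidableRel G.Adj] {ℓ : ℕ} (col : V → Fin ℓ) (α : ℝ)
    (d' : ℕ) (T : RootedTreeOn ι) (B : ι → Finset V) : Prop :=
  (∀ t : ι, (T.children t).Nonempty → (T.children t).card = d') ∧
  (∀ t : ι, IsBud G col α (B t)) ∧
  (∃ c : ι → Fin ℓ, Function.Injective c ∧ ∀ t : ι, B t ⊆ colClass col (c t)) ∧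
  (∀ s t : ι, s ≠ t → T.parent t ≠ s → T.parent s ≠ t → Anti G (B s) (B t)) ∧
  (∀ t : ι, t ≠ T.root → ∀ v ∈ B (T.parent t), ∃ w ∈ B t, G.Adj v w)

/-- An `(α, h, d)`-junior caterpillar in the `ℓ`-coloured graph `G`: an induced path
`P` on `h` vertices together with a colour-compatible (jointly with the path vertices)
family of pairwise anti-adjacent `α`-buds `B i j` with `N(B i j) ∩ V(P) = {P i}`. -/
def IsJuniorCat {V : Type} [Fintype V] [DecidableEq V] (G : SimpleGraph V)
    [DecidableRel G.Adj] {ℓ : ℕ} (col : V → Fin ℓ) (α : ℝ) (h d : ℕ)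
    (P : Fin h → V) (B : Fin h → Fin d → Finset V) : Prop :=
  IsIndPath G P ∧
  (∀ (i : Fin h) (j : Fin d), IsBud G col α (B i j)) ∧
  (∀ p q : Fin h × Fin d, p ≠ q → Anti G (B p.1 p.2) (B q.1 q.2)) ∧
  (∃ c : (Fin h ⊕ Fin h × Fin d) → Fin ℓ, Function.Injective c ∧
    (∀ i : Fin h, P i ∈ colClass col (c (Sum.inl i))) ∧
    (∀ (i : Fin h) (j : Fin d), B i j ⊆ colClass col (c (Sum.inr (i, j))))) ∧
  (∀ (i : Fin h) (j : Fin d),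
    Nbr G (B i j) ∩ Finset.image P Finset.univ = {P i})

/-- The family `(W i)_{i ∈ I}` of colour classes, living on the vertex set `S`, is
`ε`-clean: (a) every vertex of `S` has at most `ε·|W i|` neighbours in each class `W i`,
and (b) there is no anti-adjacent pair of disjoint sets `A ⊆ W i`, `B ⊆ W j` with
`|A| ≥ ε·|W i|` and `|B| ≥ ε·|W j|`. -/
def CleanOn {V ι : Type} [Fintype V] [DecidableEq V] (G : SimpleGraph V)
    [DecidableRel G.Adj] (S : Finset V) (I : Finset ι) (W : ι → Finset V) (ε : ℝ) : Prop :=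
  (∀ v ∈ S, ∀ i ∈ I, (((G.neighborFinset v) ∩ W i).card : ℝ) ≤ ε * (W i).card) ∧
  (∀ i ∈ I, ∀ j ∈ I, ∀ A B : Finset V, A ⊆ W i → B ⊆ W j → Disjoint A B →
    ε * ((W i).card : ℝ) ≤ A.card → ε * ((W j).card : ℝ) ≤ B.card → ¬ Anti G A B)

/-- Weight bound for the height-`k` objects produced in the attachment game. -/
def gameWeight (d : ℕ) : ℕ → ℕ
  | 0 => 1
  | k + 1 => 1 + (d + 1) * gameWeight d k

lemma gameWeight_pos (d k : ℕ) : 1 ≤ gameWeight d k := by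
  cases k <;> simp [gameWeight]

lemma gameWeight_mono (d : ℕ) : Monotone (gameWeight d) := by
  refine monotone_nat_of_le_succ fun k => ?_
  have := gameWeight_pos d k
  simp only [gameWeight]
  nlinarith

section Game

variable {κ : Type} [DecidableEq κ] {h d : ℕ}
  {St : Finset κ → (κ → ℕ) → (κ → ℕ) → Prop} {Win : Prop}

/-- One phase of the attachment game: starting from classes with at least `γ` attachments each,
reach a position where many classes have at least `γ + 1` attachments. -/
lemma attachment_game_phase
    (hstep : ∀ I k c, St I k c → 2 ≤ #I → ∀ a ∈ I, ∀ s,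
      (s = 0 ∨ (d + 1 ≤ c a ∧ s = k a + 1)) → ∃ j ∈ I.erase a,
        St (I.erase a) (Function.update k j (max (k j) s)) (Function.update c j (c j + 1)))
    (hwin : ∀ I k c, St I k c → ∀ a ∈ I, d + 1 ≤ c a → k a + 1 = h → Win)
    {γ M : ℕ} (hγ : γ ≤ d) (hM : 2 ≤ M)
    (hnext : ∀ I k c, St I k c → M ≤ #I → (∀ j ∈ I, γ + 1 ≤ c j ∧ c j ≤ d ∧ k j < h) → Win)
    (I : Finset κ) (k c : κ → ℕ) (hSt : St I k c)
    (hI : ∀ j ∈ I, γ ≤ c j ∧ c j ≤ d + 1 ∧ k j < h)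
    (huniq : ∀ i ∈ I, ∀ j ∈ I, c i = d + 1 → c j = d + 1 → i = j)
    (hsum : M * gameWeight d h ≤ ∑ j ∈ I, (1 + (c j - γ) * gameWeight d (k j))) : Win := by
  induction hn : #I generalizing I k c with
  | zero =>
    rw [card_eq_zero] at hn
    subst hn
    have := gameWeight_pos d h
    simp at hsum
    omega
  | succ n ih =>
    have hcard : M ≤ #I := by
      have hle : ∑ j ∈ I, (1 + (c j - γ) * gameWeight d (k j)) ≤ #I * gameWeight d h := by
        rw [← smul_eq_mul]
        refine sum_le_card_nsmul _ _ _ fun j hj => ?_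
        obtain ⟨-, h2, h3⟩ := hI j hj
        obtain ⟨m, rfl⟩ : ∃ m, h = m + 1 := ⟨h - 1, by omega⟩
        have h4 : gameWeight d (k j) ≤ gameWeight d m := gameWeight_mono d (by omega)
        simp only [gameWeight]
        have : (c j - γ) * gameWeight d (k j) ≤ (d + 1) * gameWeight d m :=
          Nat.mul_le_mul (by omega) h4
        omega
      exact Nat.le_of_mul_le_mul_right (hsum.trans hle) (gameWeight_pos d h)
    -- a source `a` of height `s` whose weight is at most the weight its target gains
    have main : ∀ a ∈ I, ∀ s, (s = 0 ∨ (d + 1 ≤ c a ∧ s = k a + 1)) → s < h →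
        (∀ j ∈ I.erase a, c j ≤ d) →
        1 + (c a - γ) * gameWeight d (k a) ≤ gameWeight d s → Win := by
      intro a ha s hs hsh hother hw
      obtain ⟨j, hj, hSt'⟩ := hstep I k c hSt (hM.trans hcard) a ha s hs
      refine ih _ _ _ hSt' ?_ ?_ ?_ (by rw [card_erase_of_mem ha, hn]; rfl)
      · intro i hi
        have h1 := hI i (mem_of_mem_erase hi)
        have h2 := hother i hi
        by_cases hij : i = j
        · subst hij
          simp only [Function.update_self]
          omega
        · simpa only [Function.update_of_ne hij] using h1
      · have key : ∀ i ∈ I.erase a, Function.update c j (c j + 1) i = d + 1 → i = j := by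
          intro i hi hc
          by_contra hij
          rw [Function.update_of_ne hij] at hc
          have := hother i hi
          omega
        intro i hi i' hi' hc hc'
        rw [key i hi hc, key i' hi' hc']
      · refine hsum.trans ?_
        rw [← add_sum_erase _ _ ha, ← add_sum_erase _ _ hj, ← add_sum_erase _ _ hj]
        have hrest : ∑ i ∈ (I.erase a).erase j, (1 + (Function.update c j (c j + 1) i - γ) *
              gameWeight d (Function.update k j (max (k j) s) i)) =
            ∑ i ∈ (I.erase a).erase j, (1 + (c i - γ) * gameWeight d (k i)) := by
          refine sum_congr rfl fun i hi => ?_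
          have hij := ne_of_mem_erase hi
          rw [Function.update_of_ne hij, Function.update_of_ne hij]
        rw [hrest, ← add_assoc]
        refine Nat.add_le_add_right ?_ _
        simp only [Function.update_self]
        have h1 := (hI j (mem_of_mem_erase hj)).1
        have h2 : gameWeight d (k j) ≤ gameWeight d (max (k j) s) :=
          gameWeight_mono d (le_max_left _ _)
        have h3 : gameWeight d s ≤ gameWeight d (max (k j) s) :=
          gameWeight_mono d (le_max_right _ _)
        rw [show c j + 1 - γ = (c j - γ) + 1 by omega, add_mul]
        have h4 := Nat.mul_le_mul_left (c j - γ) h2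
        omega
    by_cases hfull : ∃ a ∈ I, c a = d + 1
    · obtain ⟨a, ha, hca⟩ := hfull
      by_cases hk : k a + 1 = h
      · exact hwin I k c hSt a ha hca.ge hk
      · have := (hI a ha).2.2
        refine main a ha (k a + 1) (Or.inr ⟨hca.ge, rfl⟩) (by omega) ?_ ?_
        · intro j hj
          have h1 := hI j (mem_of_mem_erase hj)
          have h2 : c j ≠ d + 1 := fun h2 =>
            ne_of_mem_erase hj (huniq j (mem_of_mem_erase hj) a ha h2 hca)
          omega
        · simp only [gameWeight]
          have : (c a - γ) * gameWeight d (k a) ≤ (d + 1) * gameWeight d (k a) :=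
            Nat.mul_le_mul_right _ (by omega)
          omega
    · push Not at hfull
      by_cases hfresh : ∃ a ∈ I, c a = γ
      · obtain ⟨a, ha, hca⟩ := hfresh
        have := (hI a ha).2.2
        refine main a ha 0 (Or.inl rfl) (by omega) ?_ (by simp [hca, gameWeight])
        intro j hj
        have h1 := hI j (mem_of_mem_erase hj)
        have h2 := hfull j (mem_of_mem_erase hj)
        omega
      · push Not at hfresh
        refine hnext I k c hSt hcard fun j hj => ?_
        have h1 := hI j hj
        have h2 := hfull j hj
        have h3 := hfresh j hj
        omega

end Game

/-- The attachment game on sufficiently many classes is always won. -/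
lemma exists_attachment_game_bound (h d : ℕ) (hh : 1 ≤ h) : ∃ N : ℕ, 1 ≤ N ∧
    ∀ (κ : Type) [DecidableEq κ] (St : Finset κ → (κ → ℕ) → (κ → ℕ) → Prop) (Win : Prop),
    (∀ I k c, St I k c → 2 ≤ #I → ∀ a ∈ I, ∀ s,
      (s = 0 ∨ (d + 1 ≤ c a ∧ s = k a + 1)) → ∃ j ∈ I.erase a,
        St (I.erase a) (Function.update k j (max (k j) s)) (Function.update c j (c j + 1))) →
    (∀ I k c, St I k c → ∀ a ∈ I, d + 1 ≤ c a → k a + 1 = h → Win) →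
    ∀ I, N ≤ #I → St I (fun _ => 0) (fun _ => 0) → Win := by
  suffices H : ∀ m ≤ d + 1, ∃ N : ℕ, 1 ≤ N ∧
      ∀ (κ : Type) [DecidableEq κ] (St : Finset κ → (κ → ℕ) → (κ → ℕ) → Prop) (Win : Prop),
      (∀ I k c, St I k c → 2 ≤ #I → ∀ a ∈ I, ∀ s,
        (s = 0 ∨ (d + 1 ≤ c a ∧ s = k a + 1)) → ∃ j ∈ I.erase a,
          St (I.erase a) (Function.update k j (max (k j) s)) (Function.update c j (c j + 1))) →
      (∀ I k c, St I k c → ∀ a ∈ I, d + 1 ≤ c a → k a + 1 = h → Win) →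
      ∀ I k c, St I k c → N ≤ #I → (∀ j ∈ I, d + 1 - m ≤ c j ∧ c j ≤ d ∧ k j < h) → Win by
    obtain ⟨N, hN, H⟩ := H (d + 1) le_rfl
    refine ⟨N, hN, fun κ _ St Win hstep hwin I hI hSt => ?_⟩
    exact H κ St Win hstep hwin I _ _ hSt hI fun j _ => ⟨by omega, by omega, by omega⟩
  intro m
  induction m with
  | zero =>
    refine fun _ => ⟨1, le_rfl, fun κ _ St Win _ _ I k c _ hcard hI => ?_⟩
    obtain ⟨j, hj⟩ := card_pos.mp hcard
    have := hI j hj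
    omega
  | succ m ih =>
    intro hm
    obtain ⟨N, hN, H⟩ := ih (by omega)
    have hpos := gameWeight_pos d h
    refine ⟨(N + 1) * gameWeight d h, by nlinarith, ?_⟩
    intro κ _ St Win hstep hwin I k c hSt hcard hI
    refine attachment_game_phase (γ := d + 1 - (m + 1)) (M := N + 1) hstep hwin (by omega)
      (by omega) ?_ I k c hSt ?_ ?_ ?_
    · intro I k c hSt hcard hI
      refine H κ St Win hstep hwin I k c hSt (by omega) fun j hj => ?_
      have := hI j hj
      omega
    · intro j hj
      have := hI j hj
      omega
    · intro i hi j hj hc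
      have := hI i hi
      omega
    · refine hcard.trans ?_
      rw [card_eq_sum_ones]
      exact sum_le_sum fun j _ => by omega

section GraphLemmas

variable {V : Type} {G : SimpleGraph V}

lemma Anti.symm {A B : Finset V} (hAB : Anti G A B) : Anti G B A :=
  fun b hb a ha hadj => hAB a ha b hb hadj.symm

lemma Anti.mono {A A' B B' : Finset V} (hAB : Anti G A B) (hA : A' ⊆ A) (hB : B' ⊆ B) :
    Anti G A' B' :=
  fun a ha b hb => hAB a (hA ha) b (hB hb)

lemma ConnOn.nonempty {B : Finset V} (hB : ConnOn G B) : B.Nonempty := by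
  obtain ⟨x⟩ := SimpleGraph.Connected.nonempty hB
  exact ⟨x.1, x.2⟩

variable [DecidableEq V]

lemma Anti.union_right {A B C : Finset V} (hB : Anti G A B) (hC : Anti G A C) :
    Anti G A (B ∪ C) :=
  fun a ha b hb => (mem_union.mp hb).elim (hB a ha b) (hC a ha b)

/-- A connected set with at least two vertices stays connected after removing a suitable one. -/
lemma ConnOn.exists_erase {B : Finset V} (hB : ConnOn G B) (hcard : 2 ≤ #B) :
    ∃ v ∈ B, ConnOn G (B.erase v) := by
  have : Nontrivial (B : Set V) := by
    rw [Set.nontrivial_coe_sort, Finset.nontrivial_coe]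
    exact one_lt_card_iff_nontrivial.mp hcard
  obtain ⟨v, hv⟩ :=
    SimpleGraph.Connected.exists_connected_induce_compl_singleton_of_finite_nontrivial hB
  refine ⟨v.1, v.2, ?_⟩
  let f : (G.induce (B : Set V)).induce {v}ᶜ →g G.induce ((B.erase v.1 : Finset V) : Set V) :=
    { toFun := fun x => ⟨x.1.1, mem_erase.mpr ⟨fun h => x.2 (Subtype.ext h), x.1.2⟩⟩
      map_rel' := fun h => h }
  refine hv.map f fun y => ?_
  have hy := mem_erase.mp y.2
  exact ⟨⟨⟨y.1, hy.2⟩, fun h => hy.1 (congrArg Subtype.val h)⟩, rfl⟩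

lemma exists_anti_split_of_not_connOn {U : Finset V} (hU : U.Nonempty) (hc : ¬ ConnOn G U) :
    ∃ W ⊆ U, W.Nonempty ∧ (U \ W).Nonempty ∧ Anti G W (U \ W) := by
  classical
  have hne : Nonempty (U : Set V) := ⟨⟨hU.choose, hU.choose_spec⟩⟩
  have hpre : ¬ (G.induce (U : Set V)).Preconnected := fun h => hc ⟨h⟩
  simp only [SimpleGraph.Preconnected, not_forall] at hpre
  obtain ⟨x, y, hxy⟩ := hpre
  refine ⟨U.filter fun z => ∃ hz : z ∈ (U : Set V), (G.induce (U : Set V)).Reachable x ⟨z, hz⟩,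
    filter_subset _ _, ⟨x.1, ?_⟩, ⟨y.1, ?_⟩, ?_⟩
  · exact mem_filter.mpr ⟨x.2, x.2, .refl _⟩
  · rw [mem_sdiff, mem_filter]
    exact ⟨y.2, fun h => hxy h.2.2⟩
  · intro a ha b hb hab
    obtain ⟨-, haU, hxa⟩ := mem_filter.mp ha
    obtain ⟨hbU, hb⟩ := mem_sdiff.mp hb
    have hstep : (G.induce (U : Set V)).Adj ⟨a, haU⟩ ⟨b, hbU⟩ := hab
    exact hb (mem_filter.mpr ⟨hbU, hbU, hxa.trans hstep.reachable⟩)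

/-- A set without two large disjoint anti-adjacent subsets contains a large connected subset. -/
lemma exists_large_connOn {Y : Finset V} {m : ℝ} (hm : 0 < m) (hY : 4 * m ≤ #Y)
    (hanti : ∀ A B : Finset V, A ⊆ Y → B ⊆ Y → Disjoint A B → m ≤ #A → m ≤ #B →
      ¬ Anti G A B) :
    ∃ X ⊆ Y, ConnOn G X ∧ m ≤ #X := by
  classical
  have hSne : (Y.powerset.filter fun U => Anti G U (Y \ U) ∧ m ≤ #U).Nonempty := by
    refine ⟨Y, mem_filter.mpr ⟨mem_powerset_self Y, fun a _ b hb => ?_, by linarith⟩⟩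
    simp at hb
  obtain ⟨U, hU, hmin⟩ := exists_min_image _ card hSne
  simp only [mem_filter, mem_powerset] at hU hmin
  obtain ⟨hUY, hUanti, hUm⟩ := hU
  have hcompl : (#(Y \ U) : ℝ) < m := by
    by_contra! hlt
    exact hanti U (Y \ U) hUY sdiff_subset disjoint_sdiff hUm hlt hUanti
  have hUcard : (#(Y \ U) : ℝ) + #U = #Y := by
    exact_mod_cast card_sdiff_add_card_eq_card hUY
  refine ⟨U, hUY, ?_, hUm⟩
  by_contra hc
  have hUne : U.Nonempty := by
    rw [← card_pos]
    exact_mod_cast hm.trans_le hUm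
  obtain ⟨W, hWU, hW, hW', hWanti⟩ := exists_anti_split_of_not_connOn hUne hc
  have hsmall : ∀ Z ⊆ U, (U \ Z).Nonempty → Anti G Z (U \ Z) → (#Z : ℝ) < m := by
    intro Z hZU hZ hZanti
    by_contra! hlt
    have hle := hmin Z ⟨hZU.trans hUY, ?_, hlt⟩
    · have := card_sdiff_add_card_eq_card hZU
      have := card_pos.mpr hZ
      omega
    · refine (hZanti.union_right (hUanti.mono hZU le_rfl)).mono le_rfl fun x hx => ?_
      simp only [mem_sdiff, mem_union] at hx ⊢
      tauto
  have h1 := hsmall W hWU hW' hWanti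
  have h2 := hsmall (U \ W) sdiff_subset (by rwa [Finset.sdiff_sdiff_eq_self hWU])
    (by rw [Finset.sdiff_sdiff_eq_self hWU]; exact hWanti.symm)
  have h3 : (#(U \ W) : ℝ) + #W = #U := by
    exact_mod_cast card_sdiff_add_card_eq_card hWU
  linarith

variable [Fintype V] [DecidableRel G.Adj]

lemma mem_Nbr {A : Finset V} {v : V} : v ∈ Nbr G A ↔ ∃ a ∈ A, G.Adj v a := by
  simp [Nbr]

/-- If all degrees into the sets `Y i` are small, a connected set can be shrunk until it covers
half of some `Y j` but still leaves a quarter of every `Y i` uncovered. -/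
lemma exists_connOn_balanced_cover {ι : Type} {S X : Finset V} {J : Finset ι}
    {Y : ι → Finset V} (hXS : X ⊆ S) (hX : ConnOn G X)
    (hcover : ∃ j ∈ J, #(Y j) ≤ 2 * #(Y j ∩ Nbr G X))
    (hdeg : ∀ v ∈ S, ∀ i ∈ J, 4 * #(G.neighborFinset v ∩ Y i) ≤ #(Y i)) :
    ∃ B ⊆ S, ConnOn G B ∧ (∃ j ∈ J, #(Y j) ≤ 2 * #(Y j ∩ Nbr G B)) ∧
      ∀ i ∈ J, #(Y i) ≤ 4 * #(Y i \ Nbr G B) := by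
  classical
  have hSne : (S.powerset.filter fun B => ConnOn G B ∧
      ∃ j ∈ J, #(Y j) ≤ 2 * #(Y j ∩ Nbr G B)).Nonempty :=
    ⟨X, mem_filter.mpr ⟨mem_powerset.mpr hXS, hX, hcover⟩⟩
  obtain ⟨B, hB, hmin⟩ := exists_min_image _ card hSne
  simp only [mem_filter, mem_powerset] at hB hmin
  obtain ⟨hBS, hBc, hBcov⟩ := hB
  refine ⟨B, hBS, hBc, hBcov, fun i hi => ?_⟩
  obtain ⟨v, hv, hsmall⟩ : ∃ v ∈ B, 2 * #(Y i ∩ Nbr G (B.erase v)) ≤ #(Y i) := by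
    by_cases hcard : 2 ≤ #B
    · obtain ⟨v, hv, hvc⟩ := hBc.exists_erase hcard
      refine ⟨v, hv, ?_⟩
      by_contra! hlt
      have := hmin (B.erase v) ⟨(erase_subset _ _).trans hBS, hvc, i, hi, hlt.le⟩
      have := card_erase_lt_of_mem hv
      omega
    · obtain ⟨v, hv⟩ := hBc.nonempty
      have hB1 : #(B.erase v) = 0 := by rw [card_erase_of_mem hv]; omega
      refine ⟨v, hv, ?_⟩
      simp [card_eq_zero.mp hB1, Nbr]
  have hsub : Y i ∩ Nbr G B ⊆ (Y i ∩ Nbr G (B.erase v)) ∪ (G.neighborFinset v ∩ Y i) := by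
    intro x hx
    simp only [mem_inter, mem_union, mem_Nbr, SimpleGraph.mem_neighborFinset, mem_erase] at hx ⊢
    obtain ⟨hxY, a, ha, hxa⟩ := hx
    by_cases hav : a = v
    · subst hav
      exact Or.inr ⟨hxa.symm, hxY⟩
    · exact Or.inl ⟨hxY, a, ⟨hav, ha⟩, hxa⟩
  have h1 := (card_le_card hsub).trans (card_union_le _ _)
  have h2 := hdeg v (hBS hv) i hi
  have h3 := card_sdiff_add_card_inter (Y i) (Nbr G B)
  omega

end GraphLemmas

section Caterpillars

variable {V : Type} [Fintype V] [DecidableEq V] {G : SimpleGraph V} [DecidableRel G.Adj]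
  {ℓ : ℕ} {col : V → Fin ℓ} {α : ℝ} {d : ℕ}

lemma mem_colClass {i : Fin ℓ} {v : V} : v ∈ colClass col i ↔ col v = i := by
  simp [colClass]

/-- There is a junior caterpillar with `k` path vertices starting at `v` that otherwise lives
in `D`. -/
def CatFrom (G : SimpleGraph V) [DecidableRel G.Adj] (col : V → Fin ℓ) (α : ℝ) (d k : ℕ)
    (v : V) (D : Finset V) : Prop :=
  ∃ (P : Fin k → V) (B : Fin k → Fin d → Finset V), IsJuniorCat G col α k d P B ∧
    (∀ hk : 0 < k, P ⟨0, hk⟩ = v) ∧ (∀ i, 0 < i.val → P i ∈ D) ∧ ∀ i j, B i j ⊆ D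

lemma catFrom_zero (v : V) (D : Finset V) : CatFrom G col α d 0 v D := by
  refine ⟨Fin.elim0, Fin.elim0, ⟨⟨fun i => i.elim0, fun i => i.elim0⟩, fun i => i.elim0,
    fun p => p.1.elim0, ⟨Sum.elim Fin.elim0 fun p => p.1.elim0, ?_, fun i => i.elim0,
    fun i => i.elim0⟩, fun i => i.elim0⟩, fun hk => hk.false.elim, fun i => i.elim0,
    fun i => i.elim0⟩
  rintro (i | p)
  · exact i.elim0
  · exact p.1.elim0

lemma CatFrom.succ {k : ℕ} {v w : V} {T D : Finset V} (hw : CatFrom G col α d k w T)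
    (hvw : G.Adj v w) {L : Fin d → Finset V} {cL : Fin d → Fin ℓ}
    (hcL : Function.Injective cL) (hL : ∀ j, IsBud G col α (L j))
    (hLcol : ∀ j, L j ⊆ colClass col (cL j)) (hvL : ∀ j, ∃ x ∈ L j, G.Adj v x)
    (hLL : ∀ i j, i ≠ j → Anti G (L i) (L j)) (hLT : ∀ j, Anti G (L j) (insert w T))
    (hvT : ∀ x ∈ T, ¬ G.Adj v x) (hTcL : ∀ x ∈ insert w T, ∀ j, col x ≠ cL j)
    (hTv : ∀ x ∈ insert w T, col x ≠ col v) (hLv : ∀ j, cL j ≠ col v)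
    (hTD : insert w T ⊆ D) (hLD : ∀ j, L j ⊆ D) :
    CatFrom G col α d (k + 1) v D := by
  obtain ⟨P, B, ⟨⟨hPinj, hPadj⟩, hbud, hanti, ⟨c, hc, hcP, hcB⟩, hnbr⟩, hP0, hPT, hBT⟩ := hw
  have hPT' : ∀ i, P i ∈ insert w T := by
    intro i
    by_cases hi : 0 < i.val
    · exact mem_insert_of_mem (hPT i hi)
    · have : i = ⟨0, i.pos⟩ := Fin.ext (by simpa using hi)
      rw [this, hP0]
      exact mem_insert_self _ _
  have hBT' : ∀ i j, B i j ⊆ insert w T := fun i j => (hBT i j).trans (subset_insert _ _)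
  have hcT : ∀ x, ∃ y ∈ insert w T, c x = col y := by
    rintro (i | ⟨i, j⟩)
    · exact ⟨P i, hPT' i, (mem_colClass.mp (hcP i)).symm⟩
    · obtain ⟨y, hy⟩ := (hbud i j).1.nonempty
      exact ⟨y, hBT' i j hy, (mem_colClass.mp (hcB i j hy)).symm⟩
  have hvP : ∀ i, G.Adj v (P i) ↔ i.val = 0 := by
    intro i
    by_cases hi : 0 < i.val
    · exact iff_of_false (hvT _ (hPT i hi)) hi.ne'
    · have : i = ⟨0, i.pos⟩ := Fin.ext (by simpa using hi)
      rw [this, hP0]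
      simpa using hvw
  have hvne : ∀ i, v ≠ P i := fun i h => hTv _ (hPT' i) (by rw [← h])
  refine ⟨Fin.cons v P, Fin.cons L B, ⟨⟨?_, ?_⟩, ?_, ?_, ?_, ?_⟩, fun _ => rfl, ?_, ?_⟩
  · rw [Fin.cons_injective_iff]
    exact ⟨fun ⟨i, hi⟩ => hvne i hi.symm, hPinj⟩
  · intro i j
    cases i using Fin.cases with
    | zero =>
      cases j using Fin.cases with
      | zero => simp
      | succ j => simp [hvP, eq_comm]
    | succ i =>
      cases j using Fin.cases with
      | zero => simp [G.adj_comm (P i) v, hvP]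
      | succ j => simp [hPadj]
  · intro i j
    cases i using Fin.cases with
    | zero => exact hL j
    | succ i => exact hbud i j
  · rintro ⟨i, j⟩ ⟨i', j'⟩ hne
    cases i using Fin.cases with
    | zero =>
      cases i' using Fin.cases with
      | zero => exact hLL j j' fun h => hne (by rw [h])
      | succ i' => exact (hLT j).mono le_rfl (hBT' i' j')
    | succ i =>
      cases i' using Fin.cases with
      | zero => exact ((hLT j').mono le_rfl (hBT' i j)).symm
      | succ i' =>
        refine hanti (i, j) (i', j') fun h => hne ?_
        rw [Prod.mk.injEq] at h ⊢
        exact ⟨congrArg _ h.1, h.2⟩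
  · let cB : Fin (k + 1) → Fin d → Fin ℓ := Fin.cons cL fun i j => c (Sum.inr (i, j))
    let cP : Fin (k + 1) → Fin ℓ := Fin.cons (col v) fun i => c (Sum.inl i)
    have hTcL' : ∀ x j, c x ≠ cL j := fun x j => by
      obtain ⟨y, hy, hxy⟩ := hcT x
      rw [hxy]
      exact hTcL y hy j
    have hTv' : ∀ x, c x ≠ col v := fun x => by
      obtain ⟨y, hy, hxy⟩ := hcT x
      rw [hxy]
      exact hTv y hy
    refine ⟨Sum.elim cP fun p => cB p.1 p.2, Function.Injective.sumElim ?_ ?_ ?_, ?_, ?_⟩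
    · rw [Fin.cons_injective_iff]
      exact ⟨fun ⟨i, hi⟩ => hTv' _ hi, fun i i' h => Sum.inl_injective (hc h)⟩
    · rintro ⟨i, j⟩ ⟨i', j'⟩ heq
      cases i using Fin.cases with
      | zero =>
        cases i' using Fin.cases with
        | zero => exact congrArg _ (hcL heq)
        | succ i' => exact (hTcL' _ _ heq.symm).elim
      | succ i =>
        cases i' using Fin.cases with
        | zero => exact (hTcL' _ _ heq).elim
        | succ i' =>
          have h := Sum.inr_injective (hc heq)
          rw [Prod.mk.injEq] at h ⊢
          exact ⟨congrArg _ h.1, h.2⟩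
    · rintro i ⟨i', j'⟩ heq
      cases i using Fin.cases with
      | zero =>
        cases i' using Fin.cases with
        | zero => exact hLv _ heq.symm
        | succ i' => exact hTv' _ heq.symm
      | succ i =>
        cases i' using Fin.cases with
        | zero => exact hTcL' _ _ heq
        | succ i' => exact Sum.inl_ne_inr (hc heq)
    · intro i
      cases i using Fin.cases with
      | zero => exact mem_colClass.mpr rfl
      | succ i => exact hcP i
    · intro i j
      cases i using Fin.cases with
      | zero => exact hLcol j
      | succ i => exact hcB i j
  · intro i j
    ext x
    simp only [mem_inter, mem_image, mem_univ, true_and, mem_singleton]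
    cases i using Fin.cases with
    | zero =>
      constructor
      · rintro ⟨hx, i', rfl⟩
        cases i' using Fin.cases with
        | zero => rfl
        | succ i' =>
          obtain ⟨a, ha, hadj⟩ := mem_Nbr.mp hx
          exact (hLT j a ha _ (hPT' i') hadj.symm).elim
      · rintro rfl
        obtain ⟨y, hy, hadj⟩ := hvL j
        exact ⟨mem_Nbr.mpr ⟨y, hy, hadj⟩, 0, rfl⟩
    | succ i =>
      have hiff : ∀ x, (x ∈ Nbr G (B i j) ∧ ∃ i', P i' = x) ↔ x = P i := by
        intro x
        have := congrArg (x ∈ ·) (hnbr i j)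
        simpa using this
      constructor
      · rintro ⟨hx, i', rfl⟩
        cases i' using Fin.cases with
        | zero =>
          obtain ⟨a, ha, hadj⟩ := mem_Nbr.mp hx
          exact (hvT a (hBT i j ha) hadj).elim
        | succ i' => exact (hiff _).mp ⟨hx, i', rfl⟩
      · rintro rfl
        exact ⟨((hiff _).mpr rfl).1, i.succ, rfl⟩
  · intro i hi
    cases i using Fin.cases with
    | zero => exact hi.false.elim
    | succ i => exact hTD (hPT' i)
  · intro i j
    cases i using Fin.cases with
    | zero => exact hLD j
    | succ i => exact (hBT' i j).trans hTD

end Caterpillars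

section Attachments

variable {V : Type} [Fintype V] [DecidableEq V] {G : SimpleGraph V} [DecidableRel G.Adj]
  {ℓ : ℕ} {col : V → Fin ℓ} {α β : ℝ} {d : ℕ}

/-- The bud `B` of colour `a`, with tail `T`, lives in `D` and covers `Y`. -/
structure IsAttachment (G : SimpleGraph V) [DecidableRel G.Adj] (col : V → Fin ℓ) (α : ℝ)
    (Y D : Finset V) (a : Fin ℓ) (B T : Finset V) : Prop where
  subset_colClass : B ⊆ colClass col a
  isBud : IsBud G col α B
  bud_subset : B ⊆ D
  tail_subset : T ⊆ D
  cover : ∀ v ∈ Y, ∃ w ∈ B, G.Adj v w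
  color_ne : ∀ x ∈ T, col x ≠ a
  anti_tail : Anti G Y T

/-- At least `c` buds in `D` are attached to `Y`, and if `k ≠ 0` then caterpillars of length `k`
start at all vertices of one of them. -/
def Attached (G : SimpleGraph V) [DecidableRel G.Adj] (col : V → Fin ℓ) (α : ℝ) (d : ℕ)
    (Y D : Finset V) (k c : ℕ) : Prop :=
  ∃ (A : Finset (Fin ℓ)) (B T : Fin ℓ → Finset V), c ≤ #A ∧
    (∀ a ∈ A, IsAttachment G col α Y D a (B a) (T a)) ∧
    (∀ a ∈ A, ∀ b ∈ A, a ≠ b → Anti G (B a) (B b ∪ T b) ∧ ∀ x ∈ T b, col x ≠ a) ∧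
    (k = 0 ∨ ∃ a ∈ A, ∀ w ∈ B a, CatFrom G col α d k w (T a))

lemma attached_empty (Y D : Finset V) : Attached G col α d Y D 0 0 :=
  ⟨∅, fun _ => ∅, fun _ => ∅, by simp⟩

lemma Attached.mono {Y Y' D : Finset V} {k c : ℕ} (hY : Attached G col α d Y D k c)
    (hsub : Y' ⊆ Y) : Attached G col α d Y' D k c := by
  obtain ⟨A, B, T, hc, hatt, hpair, hcat⟩ := hY
  refine ⟨A, B, T, hc, fun a ha => ?_, hpair, hcat⟩
  have h := hatt a ha
  exact { h with
    cover := fun v hv => h.cover v (hsub hv)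
    anti_tail := h.anti_tail.mono hsub le_rfl }

/-- A set with `d + 1` attached buds contains starting points of longer caterpillars. -/
lemma Attached.catFrom {Y D : Finset V} {k c : ℕ} (hY : Attached G col α d Y D k c)
    (hc : d + 1 ≤ c) {v : V} (hv : v ∈ Y) (hD : ∀ x ∈ D, col x ≠ col v) :
    CatFrom G col α d (k + 1) v D := by
  obtain ⟨A, B, T, hcA, hatt, hpair, hcat⟩ := hY
  obtain ⟨a, ha, hacat⟩ : ∃ a ∈ A, ∀ w ∈ B a, CatFrom G col α d k w (T a) := by
    rcases hcat with rfl | hcat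
    · obtain ⟨a, ha⟩ := card_pos.mp (by omega : 0 < #A)
      exact ⟨a, ha, fun w _ => catFrom_zero w _⟩
    · exact hcat
  obtain ⟨w, hw, hvw⟩ := (hatt a ha).cover v hv
  have hdA : d ≤ #(A.erase a) := by rw [card_erase_of_mem ha]; omega
  let e := orderEmbOfCardLe (A.erase a) hdA
  have he : ∀ j, e j ∈ A.erase a := orderEmbOfCardLe_mem _ hdA
  have heA : ∀ j, e j ∈ A := fun j => mem_of_mem_erase (he j)
  have hea : ∀ j, e j ≠ a := fun j => ne_of_mem_erase (he j)
  have hwcol : col w = a := mem_colClass.mp ((hatt a ha).subset_colClass hw)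
  have hwT : insert w (T a) ⊆ B a ∪ T a :=
    insert_subset (mem_union_left _ hw) subset_union_right
  have hwD : insert w (T a) ⊆ D :=
    insert_subset ((hatt a ha).bud_subset hw) (hatt a ha).tail_subset
  refine (hacat w hw).succ hvw (L := fun j => B (e j)) e.injective
    (fun j => (hatt _ (heA j)).isBud) (fun j => (hatt _ (heA j)).subset_colClass)
    (fun j => (hatt _ (heA j)).cover v hv) ?_ ?_ ((hatt a ha).anti_tail v hv) ?_
    (fun x hx => hD x (hwD hx)) ?_ hwD (fun j => (hatt _ (heA j)).bud_subset)
  · exact fun i j hij => (hpair _ (heA i) _ (heA j) (e.injective.ne hij)).1.mono le_rfl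
      subset_union_left
  · exact fun j => (hpair _ (heA j) a ha (hea j)).1.mono le_rfl hwT
  · intro x hx j
    rcases mem_insert.mp hx with rfl | hx
    · rw [hwcol]
      exact (hea j).symm
    · exact (hpair _ (heA j) a ha (hea j)).2 x hx
  · intro j
    obtain ⟨y, hy⟩ := (hatt _ (heA j)).isBud.1.nonempty
    rw [← mem_colClass.mp ((hatt _ (heA j)).subset_colClass hy)]
    exact hD y ((hatt _ (heA j)).bud_subset hy)

/-- Attaching one more bud. -/
lemma Attached.insert {Y D B₀ T₀ : Finset V} {k c s : ℕ} {a₀ : Fin ℓ}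
    (hY : Attached G col α d Y D k c)
    (hatt₀ : IsAttachment G col α Y (D ∪ (B₀ ∪ T₀)) a₀ B₀ T₀)
    (hD : ∀ x ∈ D, col x ≠ a₀) (hDT : ∀ x ∈ D, ∀ y ∈ T₀, col x ≠ col y)
    (hanti : Anti G D (B₀ ∪ T₀)) (hcat₀ : ∀ w ∈ B₀, CatFrom G col α d s w T₀) :
    Attached G col α d Y (D ∪ (B₀ ∪ T₀)) (max k s) (c + 1) := by
  obtain ⟨A, B, T, hc, hatt, hpair, hcat⟩ := hY
  have hcolA : ∀ a ∈ A, ∃ x ∈ D, col x = a := by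
    intro a ha
    obtain ⟨x, hx⟩ := (hatt a ha).isBud.1.nonempty
    exact ⟨x, (hatt a ha).bud_subset hx, mem_colClass.mp ((hatt a ha).subset_colClass hx)⟩
  have ha₀ : a₀ ∉ A := by
    intro h
    obtain ⟨x, hx, hxa⟩ := hcolA a₀ h
    exact hD x hx hxa
  have hne : ∀ a ∈ A, a ≠ a₀ := fun a ha h => ha₀ (h ▸ ha)
  refine ⟨Insert.insert a₀ A, Function.update B a₀ B₀, Function.update T a₀ T₀, ?_, ?_, ?_, ?_⟩
  · rw [card_insert_of_notMem ha₀]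
    omega
  · intro a ha
    rcases mem_insert.mp ha with rfl | ha
    · simpa only [Function.update_self] using hatt₀
    · rw [Function.update_of_ne (hne a ha), Function.update_of_ne (hne a ha)]
      have h := hatt a ha
      exact { h with
        bud_subset := h.bud_subset.trans subset_union_left
        tail_subset := h.tail_subset.trans subset_union_left }
  · intro a ha b hb hab
    rcases mem_insert.mp ha with rfl | haA
    · rcases mem_insert.mp hb with rfl | hb
      · exact (hab rfl).elim
      · rw [Function.update_self, Function.update_of_ne hab.symm,
          Function.update_of_ne hab.symm]
        have hsub := union_subset (hatt b hb).bud_subset (hatt b hb).tail_subset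
        exact ⟨(hanti.mono hsub subset_union_left).symm,
          fun x hx => hD x ((hatt b hb).tail_subset hx)⟩
    · rcases mem_insert.mp hb with rfl | hb
      · rw [Function.update_self, Function.update_of_ne hab, Function.update_self]
        refine ⟨hanti.mono (hatt a haA).bud_subset le_rfl, fun y hy h => ?_⟩
        obtain ⟨x, hx, hxa⟩ := hcolA a haA
        exact hDT x hx y hy (hxa.trans h.symm)
      · rw [Function.update_of_ne (hne a haA), Function.update_of_ne (hne b hb),
          Function.update_of_ne (hne b hb)]
        exact hpair a haA b hb hab
  · rcases le_total k s with hks | hks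
    · right
      refine ⟨a₀, mem_insert_self _ _, ?_⟩
      rw [Function.update_self, Function.update_self, max_eq_right hks]
      exact hcat₀
    · rw [max_eq_left hks]
      refine hcat.imp_right fun ⟨a, ha, hacat⟩ => ⟨a, mem_insert_of_mem ha, ?_⟩
      rwa [Function.update_of_ne (hne a ha), Function.update_of_ne (hne a ha)]

/-- A position of the attachment game: for each active class `j ∈ I`, the set `Y j` of
candidates in the class together with the set `D j` in which the buds attached to it live. -/
structure IsPosition (G : SimpleGraph V) [DecidableRel G.Adj] (col : V → Fin ℓ) (α β : ℝ)
    (d : ℕ) (I : Finset (Fin ℓ)) (Y D : Fin ℓ → Finset V) (k c : Fin ℓ → ℕ) : Prop where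
  subset_colClass : ∀ j ∈ I, Y j ⊆ colClass col j
  large : ∀ j ∈ I, β * #(colClass col j) ≤ #(Y j)
  anti_left : ∀ i ∈ I, ∀ j ∈ I, i ≠ j → Anti G (Y i) (D j)
  anti : ∀ i ∈ I, ∀ j ∈ I, i ≠ j → Anti G (D i) (D j)
  color_notMem : ∀ i ∈ I, ∀ x ∈ D i, col x ∉ I
  color_ne : ∀ i ∈ I, ∀ j ∈ I, i ≠ j → ∀ x ∈ D i, ∀ y ∈ D j, col x ≠ col y
  attached : ∀ j ∈ I, Attached G col α d (Y j) (D j) (k j) (c j)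

lemma card_colClass_pos (hα : CleanOn G univ univ (colClass col) α) (i : Fin ℓ) :
    0 < #(colClass col i) := by
  rw [card_pos, nonempty_iff_ne_empty]
  intro h
  refine hα.2 i (mem_univ _) i (mem_univ _) ∅ ∅ (empty_subset _) (empty_subset _)
    (disjoint_empty_left _) ?_ ?_ fun a ha => ?_
  · simp [h]
  · simp [h]
  · simp at ha

/-- In a clean graph every large part of a colour class contains a connected set that covers
half of some other `Y j` and leaves a quarter of each of them uncovered. -/
lemma CleanOn.exists_connOn_balanced_cover (hclean : CleanOn G univ univ (colClass col) α)
    (hα : 0 < α) (hβ : 16 * α ≤ β) {I : Finset (Fin ℓ)} {Y : Fin ℓ → Finset V}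
    (hsub : ∀ j ∈ I, Y j ⊆ colClass col j) (hlarge : ∀ j ∈ I, β * #(colClass col j) ≤ #(Y j))
    (hI : 2 ≤ #I) {a : Fin ℓ} (ha : a ∈ I) :
    ∃ B ⊆ Y a, ConnOn G B ∧ (∃ j ∈ I.erase a, #(Y j) ≤ 2 * #(Y j ∩ Nbr G B)) ∧
      ∀ i ∈ I.erase a, #(Y i) ≤ 4 * #(Y i \ Nbr G B) := by
  have hlarge' : ∀ j ∈ I, 16 * (α * #(colClass col j)) ≤ #(Y j) := fun j hj => by
    have := hlarge j hj
    have := mul_le_mul_of_nonneg_right hβ (Nat.cast_nonneg (α := ℝ) #(colClass col j))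
    linarith
  have hpos : ∀ j, 0 < α * (#(colClass col j) : ℝ) := fun j =>
    mul_pos hα (by exact_mod_cast card_colClass_pos hclean j)
  obtain ⟨X, hXY, hX, hXcard⟩ := exists_large_connOn (hpos a)
    (by linarith [hlarge' a ha, hpos a]) fun A B hA hB hAB hAc hBc =>
      hclean.2 a (mem_univ _) a (mem_univ _) A B (hA.trans (hsub a ha)) (hB.trans (hsub a ha))
        hAB hAc hBc
  obtain ⟨j, hj⟩ : (I.erase a).Nonempty := by
    rw [← card_pos, card_erase_of_mem ha]
    omega
  have hjI := mem_of_mem_erase hj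
  refine _root_.exists_connOn_balanced_cover hXY hX ⟨j, hj, ?_⟩ fun v _ i hi => ?_
  · have hlt : (#(Y j \ Nbr G X) : ℝ) < α * #(colClass col j) := by
      by_contra! hle
      refine hclean.2 a (mem_univ _) j (mem_univ _) X (Y j \ Nbr G X)
        (hXY.trans (hsub a ha)) (sdiff_subset.trans (hsub j hjI)) ?_ hXcard hle ?_
      · refine disjoint_left.mpr fun x hx hx' => ne_of_mem_erase hj ?_
        rw [← mem_colClass.mp (hsub j hjI (mem_sdiff.mp hx').1),
          mem_colClass.mp (hsub a ha (hXY hx))]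
      · intro x hx y hy hxy
        exact (mem_sdiff.mp hy).2 (mem_Nbr.mpr ⟨x, hx, hxy.symm⟩)
    have h1 : (#(Y j \ Nbr G X) : ℝ) + #(Y j ∩ Nbr G X) = #(Y j) := by
      exact_mod_cast card_sdiff_add_card_inter (Y j) (Nbr G X)
    have h2 : (#(Y j) : ℝ) ≤ 2 * #(Y j ∩ Nbr G X) := by
      linarith [hlarge' j hjI, hpos j]
    exact_mod_cast h2
  · have hiI := mem_of_mem_erase hi
    have h1 := hclean.1 v (mem_univ _) i (mem_univ _)
    have h2 : (#(G.neighborFinset v ∩ Y i) : ℝ) ≤ #(G.neighborFinset v ∩ colClass col i) := by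
      exact_mod_cast card_le_card (inter_subset_inter_left (hsub i hiI))
    have h3 : (4 : ℝ) * #(G.neighborFinset v ∩ Y i) ≤ #(Y i) := by
      linarith [hlarge' i hiI, hpos i]
    exact_mod_cast h3

/-- A move of the attachment game: the class `a` provides a bud attached to another class. -/
lemma IsPosition.exists_move (hclean : CleanOn G univ univ (colClass col) α)
    (hα : 0 < α) (hβ : 16 * α ≤ β) {I : Finset (Fin ℓ)} {Y D : Fin ℓ → Finset V}
    {k c : Fin ℓ → ℕ} (hpos : IsPosition G col α β d I Y D k c) (hI : 2 ≤ #I) {a : Fin ℓ}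
    (ha : a ∈ I) {s : ℕ} (hs : s = 0 ∨ (d + 1 ≤ c a ∧ s = k a + 1)) :
    ∃ j ∈ I.erase a, ∃ Y' D', IsPosition G col α (β / 4) d (I.erase a) Y' D'
      (Function.update k j (max (k j) s)) (Function.update c j (c j + 1)) := by
  obtain ⟨B, hBY, hB, ⟨j, hj, hcov⟩, huncov⟩ :=
    hclean.exists_connOn_balanced_cover hα hβ hpos.subset_colClass hpos.large hI ha
  have hjI := mem_of_mem_erase hj
  have hja := ne_of_mem_erase hj
  have hBcol : ∀ x ∈ B, col x = a := fun x hx =>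
    mem_colClass.mp (hpos.subset_colClass a ha (hBY hx))
  have hcatB : ∀ w ∈ B, CatFrom G col α d s w (D a) := by
    intro w hw
    rcases hs with rfl | ⟨hca, rfl⟩
    · exact catFrom_zero w _
    · refine (hpos.attached a ha).catFrom hca (hBY hw) fun x hx h => ?_
      exact hpos.color_notMem a ha x hx (by rwa [h, hBcol w hw])
  have hbud : IsBud G col α B := by
    refine ⟨hB, j, ?_⟩
    have h1 := hpos.large j hjI
    have h2 : (#(Y j) : ℝ) ≤ 2 * #(Y j ∩ Nbr G B) := by exact_mod_cast hcov
    have h3 : (#(Y j ∩ Nbr G B) : ℝ) ≤ #(Nbr G B ∩ colClass col j) := by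
      rw [inter_comm (Y j)]
      exact_mod_cast card_le_card (inter_subset_inter_left (hpos.subset_colClass j hjI))
    have h4 := mul_le_mul_of_nonneg_right hβ (Nat.cast_nonneg (α := ℝ) #(colClass col j))
    have h5 : 0 ≤ α * (#(colClass col j) : ℝ) := by positivity
    linarith
  have hBD : ∀ i ∈ I.erase a, Anti G (D i) (B ∪ D a) := fun i hi =>
    ((hpos.anti_left a ha i (mem_of_mem_erase hi) (ne_of_mem_erase hi).symm).mono hBY
      le_rfl).symm.union_right
      (hpos.anti i (mem_of_mem_erase hi) a ha (ne_of_mem_erase hi))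
  have hcolBD : ∀ i ∈ I.erase a, ∀ x ∈ D i, ∀ y ∈ B ∪ D a, col x ≠ col y := by
    intro i hi x hx y hy
    rcases mem_union.mp hy with hy | hy
    · rw [hBcol y hy]
      exact fun h => hpos.color_notMem i (mem_of_mem_erase hi) x hx (h ▸ ha)
    · exact hpos.color_ne i (mem_of_mem_erase hi) a ha (ne_of_mem_erase hi) x hx y hy
  let Y' : Fin ℓ → Finset V := fun i => if i = j then Y j ∩ Nbr G B else Y i \ Nbr G B
  let D' : Fin ℓ → Finset V := Function.update D j (D j ∪ (B ∪ D a))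
  have hYj : Y' j = Y j ∩ Nbr G B := if_pos rfl
  have hYi : ∀ i, i ≠ j → Y' i = Y i \ Nbr G B := fun i hij => if_neg hij
  have hDj : D' j = D j ∪ (B ∪ D a) := Function.update_self ..
  have hDi : ∀ i, i ≠ j → D' i = D i := fun i hij => Function.update_of_ne hij ..
  have hY'Y : ∀ i, Y' i ⊆ Y i := by
    intro i
    by_cases hij : i = j
    · rw [hij, hYj]
      exact inter_subset_left
    · rw [hYi i hij]
      exact sdiff_subset
  refine ⟨j, hj, Y', D', ?_, ?_, ?_, ?_, ?_, ?_, ?_⟩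
  · exact fun i hi => (hY'Y i).trans (hpos.subset_colClass i (mem_of_mem_erase hi))
  · intro i hi
    have h1 := hpos.large i (mem_of_mem_erase hi)
    have h2 : #(Y i) ≤ 4 * #(Y' i) := by
      by_cases hij : i = j
      · rw [hij, hYj]
        omega
      · rw [hYi i hij]
        exact huncov i hi
    have h3 : (#(Y i) : ℝ) ≤ 4 * #(Y' i) := by exact_mod_cast h2
    linarith
  · intro i hi i' hi' hne
    have hiI := mem_of_mem_erase hi
    have hold := hpos.anti_left i hiI i' (mem_of_mem_erase hi') hne
    by_cases hij : i' = j
    · subst hij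
      rw [hDj]
      refine (hold.mono (hY'Y i) le_rfl).union_right (Anti.union_right ?_ ?_)
      · rw [hYi i hne]
        intro x hx y hy hxy
        exact (mem_sdiff.mp hx).2 (mem_Nbr.mpr ⟨y, hy, hxy⟩)
      · exact (hpos.anti_left i hiI a ha (ne_of_mem_erase hi)).mono (hY'Y i) le_rfl
    · rw [hDi i' hij]
      exact hold.mono (hY'Y i) le_rfl
  · have key : ∀ i ∈ I.erase a, i ≠ j → Anti G (D i) (D j ∪ (B ∪ D a)) := fun i hi hij =>
      (hpos.anti i (mem_of_mem_erase hi) j hjI hij).union_right (hBD i hi)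
    intro i hi i' hi' hne
    by_cases hij : i = j
    · subst hij
      rw [hDj, hDi i' hne.symm]
      exact (key i' hi' hne.symm).symm
    · by_cases hij' : i' = j
      · subst hij'
        rw [hDj, hDi i hij]
        exact key i hi hij
      · rw [hDi i hij, hDi i' hij']
        exact hpos.anti i (mem_of_mem_erase hi) i' (mem_of_mem_erase hi') hne
  · intro i hi x hx hxI
    have hcolx := mem_of_mem_erase hxI
    by_cases hij : i = j
    · rw [hij, hDj, mem_union, mem_union] at hx
      rcases hx with hx | hx | hx
      · exact hpos.color_notMem j hjI x hx hcolx
      · exact ne_of_mem_erase hxI (hBcol x hx)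
      · exact hpos.color_notMem a ha x hx hcolx
    · rw [hDi i hij] at hx
      exact hpos.color_notMem i (mem_of_mem_erase hi) x hx hcolx
  · have key : ∀ i ∈ I.erase a, i ≠ j → ∀ x ∈ D i, ∀ y ∈ D j ∪ (B ∪ D a), col x ≠ col y :=
      fun i hi hij x hx y hy => (mem_union.mp hy).elim
        (hpos.color_ne i (mem_of_mem_erase hi) j hjI hij x hx y) (hcolBD i hi x hx y)
    intro i hi i' hi' hne
    by_cases hij : i = j
    · subst hij
      rw [hDj, hDi i' hne.symm]
      exact fun x hx y hy => (key i' hi' hne.symm y hy x hx).symm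
    · by_cases hij' : i' = j
      · subst hij'
        rw [hDj, hDi i hij]
        exact key i hi hij
      · rw [hDi i hij, hDi i' hij']
        exact hpos.color_ne i (mem_of_mem_erase hi) i' (mem_of_mem_erase hi') hne
  · intro i hi
    by_cases hij : i = j
    · subst hij
      rw [Function.update_self, Function.update_self, hDj]
      refine ((hpos.attached i hjI).mono (hY'Y i)).insert (a₀ := a) ⟨?_, hbud, ?_, ?_, ?_, ?_, ?_⟩
        ?_ ?_ (hBD i hj) hcatB
      · exact hBY.trans (hpos.subset_colClass a ha)
      · exact subset_union_left.trans subset_union_right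
      · exact subset_union_right.trans subset_union_right
      · intro v hv
        rw [hYj] at hv
        exact mem_Nbr.mp (mem_inter.mp hv).2
      · exact fun x hx h => hpos.color_notMem a ha x hx (h ▸ ha)
      · exact (hpos.anti_left i hjI a ha hja).mono (hY'Y i) le_rfl
      · exact fun x hx h => hpos.color_notMem i hjI x hx (h ▸ ha)
      · exact fun x hx y hy => hcolBD i hj x hx y (mem_union_right _ hy)
    · rw [Function.update_of_ne hij, Function.update_of_ne hij, hDi i hij]
      exact (hpos.attached i (mem_of_mem_erase hi)).mono (hY'Y i)

end Attachments

/-- main technical lemma: for all `h ≥ 1` and `d ≥ 0` there are a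
constant `α > 0` and an integer `ℓ₀ ≥ 1` such that every `ℓ₀`-coloured `α`-clean graph
contains an `(α, h, d)`-junior caterpillar. -/
theorem stmt5 (h d : ℕ) (hh : 1 ≤ h) :
    ∃ (α : ℝ) (ℓ₀ : ℕ), 0 < α ∧ 1 ≤ ℓ₀ ∧
      ∀ (V : Type) [Fintype V] [DecidableEq V] (G : SimpleGraph V) [DecidableRel G.Adj]
        (col : V → Fin ℓ₀),
        CleanOn G Finset.univ Finset.univ (colClass col) α →
        ∃ (P : Fin h → V) (B : Fin h → Fin d → Finset V),
          IsJuniorCat G col α h d P B := by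
  obtain ⟨N, hN, hgame⟩ := exists_attachment_game_bound h d hh
  obtain ⟨α, hα, hαN⟩ : ∃ α : ℝ, 0 < α ∧ 16 * 4 ^ N * α = 1 :=
    ⟨(16 * 4 ^ N)⁻¹, by positivity, mul_inv_cancel₀ (by positivity)⟩
  refine ⟨α, N, hα, hN, ?_⟩
  intro V _ _ G _ col hclean
  have hclassne : ∀ j, (0 : ℝ) < #(colClass col j) := fun j => by
    exact_mod_cast card_colClass_pos hclean j
  suffices H : ∃ v D, CatFrom G col α d h v D by
    obtain ⟨v, D, P, B, hPB, -⟩ := H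
    exact ⟨P, B, hPB⟩
  refine hgame (Fin N) (fun I k c => ∃ Y D, IsPosition G col α (16 * 4 ^ #I * α) d I Y D k c)
    _ ?_ ?_ univ (by simp) ?_
  · rintro I k c ⟨Y, D, hpos⟩ hI a ha s hs
    have hβ : 16 * α ≤ 16 * 4 ^ #I * α :=
      mul_le_mul_of_nonneg_right (by linarith [one_le_pow₀ (n := #I) (by norm_num : (1 : ℝ) ≤ 4)])
        hα.le
    obtain ⟨j, hj, Y', D', hpos'⟩ := hpos.exists_move hclean hα hβ hI ha hs
    refine ⟨j, hj, Y', D', ?_⟩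
    convert hpos' using 1
    rw [← card_erase_add_one ha]
    ring
  · rintro I k c ⟨Y, D, hpos⟩ a ha hca hka
    have hYne : (Y a).Nonempty := by
      have h1 := hpos.large a ha
      have h2 := hclassne a
      rw [← card_pos]
      have h3 : (0 : ℝ) < #(Y a) := (mul_pos (mul_pos (by positivity) hα) h2).trans_le h1
      exact_mod_cast h3
    obtain ⟨v, hv⟩ := hYne
    refine ⟨v, D a, hka ▸ (hpos.attached a ha).catFrom hca hv fun x hx hxv => ?_⟩
    rw [mem_colClass.mp (hpos.subset_colClass a ha hv)] at hxv
    exact hpos.color_notMem a ha x hx (hxv ▸ ha)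
  · have hβ : 16 * 4 ^ #(univ : Finset (Fin N)) * α = 1 := by
      rw [card_univ, Fintype.card_fin, hαN]
    refine ⟨colClass col, fun _ => ∅, fun _ _ => subset_rfl, fun j _ => by rw [hβ, one_mul],
      ?_, ?_, ?_, ?_, fun j _ => attached_empty _ _⟩ <;> simp [Anti]
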